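/- The digraph C_4*[2] ⊕ I*_8 has a factorization into r K_2*-factors and s C⃗_4-factors for every r ∈ {0, 1, 2, 3, 5} with r + s = 5. -/

import Mathlib

/-- A factorization of the digraph with arc set `A` (on vertex set `V`) into `k`
arc-disjoint spanning factors, where every connected component of the `i`-th factor
is a directed cycle of length `c i` (a `C⃗_{c i}`-factor; for `c i = 2` this is a
`K_2*`-factor, i.e. its components are double arcs).  The `i`-th factor is encoded by
a permutation `f i` of the vertex set, its arc set being `{(x, f i x) : x ∈ V}`;
the requirement that all components be directed `c i`-cycles says exactly that every
point of `f i` has minimal period `c i`.  The factors are pairwise arc-disjoint and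
their arc sets partition `A`. -/
def IsFactorization {V : Type} (A : Set (V × V)) {k : ℕ} (c : Fin k → ℕ) : Prop :=
  ∃ f : Fin k → Equiv.Perm V,
    (∀ (i : Fin k) (x : V), Function.minimalPeriod (⇑(f i)) x = c i) ∧
    (∀ (i j : Fin k) (x : V), f i x = f j x → i = j) ∧
    (∀ p : V × V, p ∈ A ↔ ∃ i, f i p.1 = p.2)

/-- The arc set of `C_m*[2]` on vertex set `Fin 2 × ZMod m`: here `C_m*` is the
symmetric digraph of the `m`-cycle `(0, 1, …, m-1)` on `ZMod m`, and `D[2]` has an arc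
from `(i, u)` to `(j, v)` for all `i j : Fin 2` whenever `(u, v)` is an arc of `D`. -/
def cycleStarBlowup (m : ℕ) : Set ((Fin 2 × ZMod m) × (Fin 2 × ZMod m)) :=
  {p | p.2.2 = p.1.2 + 1 ∨ p.1.2 = p.2.2 + 1}

/-- The arc set of `I*_{2m}` on vertex set `Fin 2 × ZMod m`: the `K_2*`-factor whose
components are the double arcs joining `(0, i)` and `(1, i)` for each `i : ZMod m`. -/
def IStar (m : ℕ) : Set ((Fin 2 × ZMod m) × (Fin 2 × ZMod m)) :=
  {p | p.1.2 = p.2.2 ∧ p.1.1 ≠ p.2.1}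

/-- The arc set of `F_m*[2]` on vertex set `Fin 2 × ZMod m` (for even `m`): here `F_m`
is the 1-factor of `K_m` on `ZMod m` with edges `{0, m/2}` and `{i, m - i}` for
`1 ≤ i ≤ m/2 - 1`, `F_m*` is its symmetric digraph, and `D[2]` has an arc from `(i, u)`
to `(j, v)` for all `i j : Fin 2` whenever `(u, v)` is an arc of `D`. -/
def FStarBlowup (m : ℕ) : Set ((Fin 2 × ZMod m) × (Fin 2 × ZMod m)) :=
  {p | (p.1.2 = 0 ∧ p.2.2 = ((m / 2 : ℕ) : ZMod m)) ∨
       (p.1.2 = ((m / 2 : ℕ) : ZMod m) ∧ p.2.2 = 0) ∨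
       (p.1.2 ≠ 0 ∧ p.1.2 ≠ ((m / 2 : ℕ) : ZMod m) ∧ p.2.2 = -p.1.2)}

/-- The arc set of `Γ*_m = C*[2] ⊕ F_m*[2]`, the arc-disjoint union of `C*[2]` and
`F_m*[2]` on vertex set `Fin 2 × ZMod m`. -/
def GammaStar (m : ℕ) : Set ((Fin 2 × ZMod m) × (Fin 2 × ZMod m)) :=
  cycleStarBlowup m ∪ FStarBlowup m

theorem minimalPeriod_eq_two {V : Type*} {f : V → V} {x : V} (h : f (f x) = x) (hx : f x ≠ x) :
    Function.minimalPeriod f x = 2 :=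
  Function.minimalPeriod_eq_prime (p := 2) h hx

theorem minimalPeriod_eq_four {V : Type*} {f : V → V} {x : V} (h : f (f (f (f x))) = x)
    (hx : f (f x) ≠ x) : Function.minimalPeriod f x = 4 :=
  Function.minimalPeriod_eq_prime_pow (p := 2) (k := 1) hx h

/-- A criterion for factorizations into double-arc and directed 4-cycle factors whose hypotheses
are decidable on a finite vertex set. -/
theorem IsFactorization.of_two_or_four {V : Type} {A : Set (V × V)} {k : ℕ} (r : ℕ)
    (f : Fin k → Equiv.Perm V)
    (htwo : ∀ (i : Fin k) (x : V), (i : ℕ) < r → f i (f i x) = x ∧ f i x ≠ x)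
    (hfour : ∀ (i : Fin k) (x : V), ¬(i : ℕ) < r → f i (f i (f i (f i x))) = x ∧ f i (f i x) ≠ x)
    (hdisj : ∀ (i j : Fin k) (x : V), f i x = f j x → i = j)
    (hcover : ∀ x y, (x, y) ∈ A ↔ ∃ i, f i x = y) :
    IsFactorization A (fun i : Fin k => if (i : ℕ) < r then 2 else 4) := by
  refine ⟨f, fun i x => ?_, hdisj, fun p => hcover p.1 p.2⟩
  dsimp only
  split_ifs with hi
  · exact minimalPeriod_eq_two (htwo i x hi).1 (htwo i x hi).2
  · exact minimalPeriod_eq_four (hfour i x hi).1 (hfour i x hi).2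

instance (m : ℕ) : DecidablePred (· ∈ cycleStarBlowup m ∪ IStar m) := fun p =>
  inferInstanceAs (Decidable ((p.2.2 = p.1.2 + 1 ∨ p.1.2 = p.2.2 + 1) ∨
    (p.1.2 = p.2.2 ∧ p.1.1 ≠ p.2.1)))

namespace BlowupFour

/-- The double arcs of `I*_8`. -/
def matchI : Equiv.Perm (Fin 2 × ZMod 4) :=
  c[(0, 0), (1, 0)] * c[(0, 1), (1, 1)] * c[(0, 2), (1, 2)] * c[(0, 3), (1, 3)]

/-- Double arcs across the edges `{0, 1}` and `{2, 3}` of `C_4`, switching layers. -/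
def matchCross : Equiv.Perm (Fin 2 × ZMod 4) :=
  c[(0, 0), (1, 1)] * c[(0, 1), (1, 0)] * c[(0, 2), (1, 3)] * c[(0, 3), (1, 2)]

/-- Double arcs over the edges `{0, 1}` and `{2, 3}` of `C_4`, within each layer. -/
def matchFlat : Equiv.Perm (Fin 2 × ZMod 4) :=
  c[(0, 0), (0, 1)] * c[(1, 0), (1, 1)] * c[(0, 2), (0, 3)] * c[(1, 2), (1, 3)]

/-- Double arcs over the edges `{0, 3}` and `{1, 2}` of `C_4`, within each layer. -/
def matchFlat' : Equiv.Perm (Fin 2 × ZMod 4) :=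
  c[(0, 0), (0, 3)] * c[(1, 0), (1, 3)] * c[(0, 1), (0, 2)] * c[(1, 1), (1, 2)]

/-- Double arcs across the edges `{0, 3}` and `{1, 2}` of `C_4`, switching layers. -/
def matchCross' : Equiv.Perm (Fin 2 × ZMod 4) :=
  c[(0, 0), (1, 3)] * c[(0, 3), (1, 0)] * c[(0, 1), (1, 2)] * c[(0, 2), (1, 1)]

/-- Together with its inverse, it covers the arcs of `matchI` and `matchCross`. -/
def quadI : Equiv.Perm (Fin 2 × ZMod 4) :=
  c[(0, 0), (1, 0), (0, 1), (1, 1)] * c[(0, 2), (1, 2), (0, 3), (1, 3)]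

/-- Together with its inverse, it covers the arcs of `matchCross` and `matchFlat`. -/
def quad : Equiv.Perm (Fin 2 × ZMod 4) :=
  c[(0, 0), (0, 1), (1, 0), (1, 1)] * c[(0, 2), (0, 3), (1, 2), (1, 3)]

/-- Together with its inverse, it covers the arcs of `matchCross'` and `matchFlat'`. -/
def quad' : Equiv.Perm (Fin 2 × ZMod 4) :=
  c[(0, 0), (0, 3), (1, 0), (1, 3)] * c[(0, 1), (0, 2), (1, 1), (1, 2)]

/-- With `turnB` and `turnC`, it covers all arcs outside `matchI` and `matchCross`. -/
def turnA : Equiv.Perm (Fin 2 × ZMod 4) :=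
  c[(0, 0), (0, 1), (0, 2), (0, 3)] * c[(1, 0), (1, 1), (1, 2), (1, 3)]

/-- With `turnA` and `turnC`, it covers all arcs outside `matchI` and `matchCross`. -/
def turnB : Equiv.Perm (Fin 2 × ZMod 4) :=
  c[(0, 0), (0, 3), (1, 0), (1, 3)] * c[(0, 1), (1, 2), (1, 1), (0, 2)]

/-- With `turnA` and `turnB`, it covers all arcs outside `matchI` and `matchCross`. -/
def turnC : Equiv.Perm (Fin 2 × ZMod 4) :=
  c[(0, 0), (1, 3), (1, 2), (0, 1)] * c[(0, 2), (1, 1), (1, 0), (0, 3)]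

end BlowupFour

set_option maxRecDepth 4000 in
/-- The digraph `C_4*[2] ⊕ I*_8` (on vertex set `Fin 2 × ZMod 4`) has a factorization
into `r` `K_2*`-factors and `s` `C⃗_4`-factors for every `r ∈ {0, 1, 2, 3, 5}` with
`r + s = 5`. -/
theorem cycleStarBlowup_four_IStar_K2_C4 (r s : ℕ)
    (hr : r = 0 ∨ r = 1 ∨ r = 2 ∨ r = 3 ∨ r = 5) (hrs : r + s = 5) :
    IsFactorization (cycleStarBlowup 4 ∪ IStar 4)
      (fun i : Fin (r + s) => if (i : ℕ) < r then 2 else 4) := by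
  rcases hr with rfl | rfl | rfl | rfl | rfl
  · obtain rfl : s = 5 := by omega
    exact .of_two_or_four 0 ![BlowupFour.quadI, BlowupFour.quadI⁻¹, BlowupFour.turnA,
      BlowupFour.turnB, BlowupFour.turnC] (by decide) (by decide) (by decide) (by decide)
  · obtain rfl : s = 4 := by omega
    exact .of_two_or_four 1 ![BlowupFour.matchI, BlowupFour.quad, BlowupFour.quad⁻¹,
      BlowupFour.quad', BlowupFour.quad'⁻¹] (by decide) (by decide) (by decide) (by decide)
  · obtain rfl : s = 3 := by omega
    exact .of_two_or_four 2 ![BlowupFour.matchI, BlowupFour.matchCross, BlowupFour.turnA,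
      BlowupFour.turnB, BlowupFour.turnC] (by decide) (by decide) (by decide) (by decide)
  · obtain rfl : s = 2 := by omega
    exact .of_two_or_four 3 ![BlowupFour.matchI, BlowupFour.matchCross, BlowupFour.matchFlat,
      BlowupFour.quad', BlowupFour.quad'⁻¹] (by decide) (by decide) (by decide) (by decide)
  · obtain rfl : s = 0 := by omega
    exact .of_two_or_four 5 ![BlowupFour.matchI, BlowupFour.matchCross, BlowupFour.matchFlat,
      BlowupFour.matchCross', BlowupFour.matchFlat'] (by decide) (by decide) (by decide) (by decide)
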